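/- arXiv:2102.03760 — 2 statements merged into one kernel-verified Lean document; each statement's English description precedes it below -/
import Mathlib

section
/- Let n ≥ 3 and let N be the N-matrix of a mixed cycle on vertex set ZMod n: N_{i,j} ≠ 0 iff j = i + 1 or j = i − 1 (mod n). Let w = ∏_{i ∈ ZMod n} N_{i,i+1} be the weight of the cycle (w is a sixth root of unity). Then the dimension of the kernel of N equals 2 if either (n ≡ 2 mod 4 and w = −1) or (n ≡ 0 mod 4 and w = 1), and equals 0 in all other cases (in particular whenever n is odd). -/
open Matrix Complex

/-- The sixth root of unity `ω = (1 + i√3)/2`. -/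
noncomputable def ω6 : ℂ := (1 + Complex.I * Real.sqrt 3) / 2

lemma om_sq : ω6 ^ 2 = ω6 - 1 := by
  have h : ((Real.sqrt 3 : ℝ) : ℂ) ^ 2 = 3 := by
    rw [← Complex.ofReal_pow, Real.sq_sqrt (by norm_num)]; norm_num
  unfold ω6
  linear_combination (1 / 4 : ℂ) * (Real.sqrt 3 : ℂ) ^ 2 * Complex.I_sq - (1 / 4 : ℂ) * h

lemma om_star_sq : (star ω6) ^ 2 = star ω6 - 1 := by
  rw [← star_pow, om_sq]; simp

lemma om_mul_star : ω6 * star ω6 = 1 := by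
  have h : ((Real.sqrt 3 : ℝ) : ℂ) ^ 2 = 3 := by
    rw [← Complex.ofReal_pow, Real.sq_sqrt (by norm_num)]; norm_num
  have hs : star ω6 = (1 - Complex.I * Real.sqrt 3) / 2 := by
    simp [ω6, sub_eq_add_neg]
  rw [hs]
  unfold ω6
  linear_combination (-1 / 4 : ℂ) * (Real.sqrt 3 : ℂ) ^ 2 * Complex.I_sq + (1 / 4 : ℂ) * h

lemma pow6_of_sq {z : ℂ} (h : z ^ 2 = z - 1) : z ^ 6 = 1 := by
  have h3 : z ^ 3 = -1 := by linear_combination (z + 1) * h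
  linear_combination (z ^ 3 - 1) * h3

lemma entry_props {z : ℂ} (h : z ∈ ({0, 1, ω6, star ω6} : Set ℂ)) (h0 : z ≠ 0) :
    z ^ 6 = 1 ∧ z * star z = 1 := by
  simp only [Set.mem_insert_iff, Set.mem_singleton_iff] at h
  rcases h with rfl | rfl | rfl | rfl
  · exact absurd rfl h0
  · simp
  · exact ⟨pow6_of_sq om_sq, om_mul_star⟩
  · refine ⟨pow6_of_sq om_star_sq, ?_⟩
    rw [star_star, mul_comm]; exact om_mul_star

/-- The solution of `z (k+2) = - z k` with initial values `c, d`. -/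
noncomputable def zseq (c d : ℂ) (k : ℕ) : ℂ := (-1) ^ (k / 2) * (if k % 2 = 0 then c else d)

lemma zseq_add_two (c d : ℂ) (k : ℕ) : zseq c d (k + 2) = - zseq c d k := by
  unfold zseq
  rw [show (k + 2) / 2 = k / 2 + 1 by omega, show (k + 2) % 2 = k % 2 by omega, pow_succ]
  ring

lemma zseq_add_even (c d : ℂ) (k m n : ℕ) (hn : n = 2 * m) :
    zseq c d (k + n) = (-1) ^ m * zseq c d k := by
  subst hn
  unfold zseq
  rw [show (k + 2 * m) / 2 = m + k / 2 by omega, show (k + 2 * m) % 2 = k % 2 by omega, pow_add]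
  ring

lemma eq_zseq (y : ℕ → ℂ) (hy : ∀ k, y (k + 2) = - y k) (k : ℕ) : y k = zseq (y 0) (y 1) k := by
  induction k using Nat.twoStepInduction with
  | zero => simp [zseq]
  | one => simp [zseq]
  | more k h1 h2 => rw [hy, zseq_add_two, h1]

lemma mulVec_cycle (n : ℕ) (hn : 3 ≤ n) [NeZero n]
    (N : Matrix (ZMod n) (ZMod n) ℂ)
    (hcyc : ∀ i j : ZMod n, N i j ≠ 0 ↔ (j = i + 1 ∨ j = i - 1)) (x : ZMod n → ℂ) (i : ZMod n) :
    (N *ᵥ x) i = N i (i + 1) * x (i + 1) + N i (i - 1) * x (i - 1) := by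
  have hne : i + 1 ≠ i - 1 := by
    intro h
    have h2 : ((2 : ℕ) : ZMod n) = 0 := by push_cast; linear_combination h
    rw [ZMod.natCast_eq_zero_iff] at h2
    exact absurd (Nat.le_of_dvd (by norm_num) h2) (by omega)
  unfold Matrix.mulVec dotProduct
  refine Fintype.sum_eq_add _ _ hne ?_
  rintro j ⟨h1, h2⟩
  have : N i j = 0 := by
    by_contra h
    rcases (hcyc i j).1 h with h | h
    · exact h1 h
    · exact h2 h
  change N i j * x j = 0
  rw [this, zero_mul]

lemma prod_zmod (n : ℕ) [NeZero n] (f : ZMod n → ℂ) :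
    ∏ j ∈ Finset.range n, f (j : ZMod n) = ∏ i, f i := by
  refine Finset.prod_bij' (fun j _ => (j : ZMod n)) (fun i _ => i.val) ?_ ?_ ?_ ?_ ?_
  · intros; simp
  · intro a _; simpa using ZMod.val_lt a
  · intro a ha; exact ZMod.val_cast_of_lt (by simpa using ha)
  · intro a _; simp
  · intros; rfl

/-- For a mixed cycle of order `n ≥ 3` with weight `w`, the nullity of its
N-matrix is `2` when (`n ≡ 2 (mod 4)` and `w = −1`) or (`n ≡ 0 (mod 4)` and `w = 1`), and is
`0` in all other cases. -/
theorem nullity_of_mixed_cycle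
    (n : ℕ) (hn : 3 ≤ n) [NeZero n]
    (N : Matrix (ZMod n) (ZMod n) ℂ) (hherm : N.IsHermitian)
    (hdiag : ∀ u, N u u = 0)
    (hent : ∀ u v, N u v ∈ ({0, 1, ω6, star ω6} : Set ℂ))
    (hcyc : ∀ i j : ZMod n, N i j ≠ 0 ↔ (j = i + 1 ∨ j = i - 1)) :
    Module.finrank ℂ ↥(LinearMap.ker N.mulVecLin) =
      if (n % 4 = 2 ∧ (∏ i : ZMod n, N i (i + 1)) = -1) ∨
         (n % 4 = 0 ∧ (∏ i : ZMod n, N i (i + 1)) = 1)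
      then 2 else 0 := by
  have hp : ∀ i, N i (i + 1) ^ 6 = 1 ∧ N i (i + 1) * star (N i (i + 1)) = 1 := fun i =>
    entry_props (hent _ _) ((hcyc _ _).2 (Or.inl rfl))
  set w := ∏ i : ZMod n, N i (i + 1) with hw
  have hw6 : w ^ 6 = 1 := by
    rw [hw, ← Finset.prod_pow]; exact Finset.prod_eq_one fun i _ => (hp i).1
  have hw0 : w ≠ 0 := by
    intro h; rw [h] at hw6; norm_num at hw6
  let b : ℕ → ℂ := fun k => N (k : ZMod n) ((k : ZMod n) + 1)
  have hb : ∀ k, b k * star (b k) = 1 := fun k => (hp _).2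
  let P : ℕ → ℂ := fun k => ∏ j ∈ Finset.range k, b j
  have hPs : ∀ k, P (k + 1) = P k * b k := fun k => Finset.prod_range_succ _ _
  have hPP : ∀ k, P k * star (P k) = 1 := by
    intro k
    induction k with
    | zero => simp [P]
    | succ k ih =>
      rw [hPs, star_mul]
      linear_combination (b k * star (b k)) * ih + hb k
  have hP0 : ∀ k, P k ≠ 0 := fun k h => by
    have := hPP k
    rw [h, zero_mul] at this
    exact zero_ne_one this
  have hPn : ∀ k, P (k + n) = w * P k := by
    intro k
    change ∏ j ∈ Finset.range (k + n), b j = w * ∏ j ∈ Finset.range k, b j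
    rw [add_comm k n, Finset.prod_range_add]
    congr 1
    · exact prod_zmod n (fun i => N i (i + 1))
    · refine Finset.prod_congr rfl fun j _ => ?_
      simp [b]
  -- kernel condition
  have hker : ∀ x : ZMod n → ℂ, x ∈ LinearMap.ker N.mulVecLin ↔
      ∀ k : ℕ, b (k + 1) * x ((k + 2 : ℕ) : ZMod n) + star (b k) * x (k : ZMod n) = 0 := by
    intro x
    have key : ∀ k : ℕ, (N *ᵥ x) ((k + 1 : ℕ) : ZMod n) =
        b (k + 1) * x ((k + 2 : ℕ) : ZMod n) + star (b k) * x (k : ZMod n) := by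
      intro k
      rw [mulVec_cycle n hn N hcyc]
      have e1 : ((k + 1 : ℕ) : ZMod n) - 1 = (k : ZMod n) := by push_cast; ring
      have e2 : ((k + 1 : ℕ) : ZMod n) + 1 = ((k + 2 : ℕ) : ZMod n) := by push_cast; ring
      have e3 : ((k + 1 : ℕ) : ZMod n) = (k : ZMod n) + 1 := by push_cast; ring
      have e4 : N ((k + 1 : ℕ) : ZMod n) (k : ZMod n) = star (b k) := by
        rw [← hherm.apply, e3]
      have e5 : b (k + 1) = N ((k + 1 : ℕ) : ZMod n) ((k + 2 : ℕ) : ZMod n) := by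
        rw [← e2]
      rw [e1, e2, e4, e5]
    rw [LinearMap.mem_ker, Matrix.mulVecLin_apply]
    constructor
    · intro h k
      rw [← key, h]; rfl
    · intro h
      funext i
      have : i = (((i - 1).val + 1 : ℕ) : ZMod n) := by
        push_cast; rw [ZMod.natCast_zmod_val]; ring
      rw [this, key, h]; rfl
  have hfwd : ∀ x ∈ LinearMap.ker N.mulVecLin, ∀ k : ℕ,
      P k * x (k : ZMod n) = zseq (x 0) (b 0 * x 1) k := by
    intro x hx k
    have h := eq_zseq (fun k => P k * x (k : ZMod n)) ?_ k
    · simpa [P] using h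
    · intro k
      have h1 := (hker x).1 hx k
      change P (k + 2) * x ((k + 2 : ℕ) : ZMod n) = -(P k * x (k : ZMod n))
      rw [show k + 2 = k + 1 + 1 from rfl, hPs (k + 1), hPs k]
      rw [show k + 2 = k + 1 + 1 from rfl] at h1
      linear_combination (P k * b k) * h1 - P k * x k * hb k
  have hb0 : b 0 ≠ 0 := fun h => by
    have := hb 0
    rw [h, zero_mul] at this
    exact zero_ne_one this
  have hinj : ∀ x ∈ LinearMap.ker N.mulVecLin, x 0 = 0 → x 1 = 0 → x = 0 := by
    intro x hx h0 h1
    funext i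
    have h := hfwd x hx i.val
    rw [h0, h1, ZMod.natCast_zmod_val] at h
    simp only [zseq, mul_zero, ite_self] at h
    exact (mul_eq_zero.1 h).resolve_left (hP0 _)
  have hper : ∀ x ∈ LinearMap.ker N.mulVecLin, ∀ k : ℕ,
      zseq (x 0) (b 0 * x 1) (k + n) = w * zseq (x 0) (b 0 * x 1) k := by
    intro x hx k
    rw [← hfwd x hx, ← hfwd x hx, hPn]
    simp [mul_assoc]
  rcases Nat.even_or_odd' n with ⟨m, hm | hm⟩
  · by_cases hwm : w = (-1) ^ m
    · rw [if_pos]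
      swap
      · rcases Nat.even_or_odd m with he | ho
        · right
          rw [he.neg_one_pow] at hwm
          obtain ⟨r, hr⟩ := he
          exact ⟨by omega, hwm⟩
        · left
          rw [ho.neg_one_pow] at hwm
          obtain ⟨r, hr⟩ := ho
          exact ⟨by omega, hwm⟩
      have hsw : w * star w = 1 := by
        rw [hwm, star_pow, ← mul_pow]; simp
      let F : LinearMap.ker N.mulVecLin →ₗ[ℂ] ℂ × ℂ :=
        ((LinearMap.proj (0 : ZMod n)).prod (LinearMap.proj (1 : ZMod n))).comp
          (LinearMap.ker N.mulVecLin).subtype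
      have hF : Function.Bijective F := by
        constructor
        · rw [injective_iff_map_eq_zero]
          rintro ⟨x, hx⟩ h
          have h' : (x 0, x 1) = ((0, 0) : ℂ × ℂ) := h
          rw [Prod.mk.injEq] at h'
          exact Subtype.ext (hinj x hx h'.1 h'.2)
        · rintro ⟨c, d⟩
          let X : ℕ → ℂ := fun k => star (P k) * zseq c (b 0 * d) k
          have hX : Function.Periodic X n := by
            intro k
            have e : zseq c (b 0 * d) (k + n) = w * zseq c (b 0 * d) k := by
              rw [zseq_add_even _ _ _ _ _ hm, hwm]
            simp only [X]
            rw [hPn, e, star_mul]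
            linear_combination (star (P k) * zseq c (b 0 * d) k) * hsw
          let x : ZMod n → ℂ := fun i => X i.val
          have hxX : ∀ k : ℕ, x (k : ZMod n) = X k := by
            intro k
            simp only [x]
            rw [ZMod.val_natCast, hX.map_mod_nat]
          have hx : x ∈ LinearMap.ker N.mulVecLin := by
            rw [hker]
            intro k
            rw [hxX, hxX]
            simp only [X]
            rw [zseq_add_two, show k + 2 = k + 1 + 1 from rfl, hPs (k + 1), hPs k, star_mul,
              star_mul]
            linear_combination (-(star (b k) * star (P k) * zseq c (b 0 * d) k)) * hb (k + 1)
          refine ⟨⟨x, hx⟩, ?_⟩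
          change (x 0, x 1) = (c, d)
          have h0 := hxX 0
          have h1 := hxX 1
          rw [Nat.cast_zero] at h0
          rw [Nat.cast_one] at h1
          rw [h0, h1]
          have e0 : X 0 = c := by simp [X, P, zseq]
          have e1 : X 1 = d := by
            have : X 1 = star (b 0) * (b 0 * d) := by simp [X, P, zseq]
            rw [this]
            linear_combination d * hb 0
          rw [e0, e1]
      rw [(LinearEquiv.ofBijective F hF).finrank_eq]
      simp
    · rw [if_neg]
      swap
      · rintro (⟨h1, h2⟩ | ⟨h1, h2⟩)
        · apply hwm
          rw [Odd.neg_one_pow (Nat.odd_iff.2 (by omega)), h2]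
        · apply hwm
          rw [Even.neg_one_pow (Nat.even_iff.2 (by omega)), h2]
      rw [Submodule.finrank_eq_zero, Submodule.eq_bot_iff]
      intro x hx
      have hz : ∀ k, zseq (x 0) (b 0 * x 1) k = 0 := by
        intro k
        have h := hper x hx k
        rw [zseq_add_even _ _ _ _ _ hm] at h
        have h' : (w - (-1) ^ m) * zseq (x 0) (b 0 * x 1) k = 0 := by linear_combination -h
        exact (mul_eq_zero.1 h').resolve_left (sub_ne_zero.2 hwm)
      have h0 := hz 0
      have h1 := hz 1
      simp [zseq, hb0] at h0 h1
      exact hinj x hx h0 h1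
  · rw [if_neg (by omega), Submodule.finrank_eq_zero, Submodule.eq_bot_iff]
    intro x hx
    have hw2 : w ^ 2 + 1 ≠ 0 := by
      intro h
      have : (2 : ℂ) = 0 := by
        linear_combination (w ^ 4 - w ^ 2 + 1) * h - hw6
      norm_num at this
    have hz : ∀ k, zseq (x 0) (b 0 * x 1) k = 0 := by
      intro k
      have h := hper x hx k
      have h2 := hper x hx (k + n)
      rw [h, show k + n + n = k + 2 * n by ring, zseq_add_even _ _ _ _ _ rfl,
        Odd.neg_one_pow ⟨m, hm⟩] at h2
      have h' : (w ^ 2 + 1) * zseq (x 0) (b 0 * x 1) k = 0 := by linear_combination -h2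
      exact (mul_eq_zero.1 h').resolve_left hw2
    have h0 := hz 0
    have h1 := hz 1
    simp [zseq, hb0] at h0 h1
    exact hinj x hx h0 h1
end

section
/- Let n ≥ 3 be odd. Let A be the (0/1) adjacency matrix of the cycle Cₙ on vertex set ZMod n (A_{i,j} = 1 iff j = i ± 1 mod n), and let N be the N-matrix of a mixed cycle on ZMod n (N_{i,j} ≠ 0 iff j = i ± 1 mod n) whose weight ∏_{i ∈ ZMod n} N_{i,i+1} equals −1 (a negative mixed cycle). Then a real number λ is an eigenvalue of A if and only if −λ is an eigenvalue of N. -/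
open Matrix Complex

lemma omega6_star : star ω6 * ω6 = 1 := by
  have h3 : ((Real.sqrt 3 : ℝ) : ℂ) * (Real.sqrt 3 : ℝ) = 3 := by
    rw [← Complex.ofReal_mul, Real.mul_self_sqrt (by norm_num)]; norm_num
  simp only [ω6, Complex.star_def, map_div₀, map_add, map_mul, map_one, Complex.conj_I,
    Complex.conj_ofReal, Complex.conj_ofNat]
  linear_combination (1 / 4 : ℂ) * h3 - (1 / 4 : ℂ) * (Real.sqrt 3 : ℝ) * (Real.sqrt 3 : ℝ) * Complex.I_mul_I

lemma prod_range_zmod (n : ℕ) [NeZero n] (c : ZMod n → ℂ) :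
    ∏ k ∈ Finset.range n, c (k : ZMod n) = ∏ i, c i := by
  refine Finset.prod_bij' (fun k _ => (k : ZMod n)) (fun i _ => i.val) ?_ ?_ ?_ ?_ ?_
  · simp
  · intro i _; simpa using ZMod.val_lt i
  · intro k hk; exact ZMod.val_cast_of_lt (by simpa using hk)
  · intro i _; simp
  · simp

lemma exists_gauge (n : ℕ) [NeZero n] (c : ZMod n → ℂ) (hc : ∀ i, star (c i) * c i = 1)
    (hp : ∏ i, c i = 1) :
    ∃ g : ZMod n → ℂ, (∀ i, star (g i) * g i = 1) ∧ ∀ i, g (i + 1) = g i * c i := by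
  refine ⟨fun i => ∏ k ∈ Finset.range i.val, c (k : ZMod n), ?_, ?_⟩
  · intro i
    simp only [star_prod, ← Finset.prod_mul_distrib, hc, Finset.prod_const_one]
  · intro i
    have h1 : (∏ k ∈ Finset.range i.val, c (k : ZMod n)) * c i
        = ∏ k ∈ Finset.range (i.val + 1), c (k : ZMod n) := by
      rw [Finset.prod_range_succ]; simp
    have h2 : ((i.val + 1 : ℕ) : ZMod n) = i + 1 := by simp
    simp only [h1]
    rcases Nat.lt_or_ge (i.val + 1) n with h | h
    · rw [← h2, ZMod.val_cast_of_lt h]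
    · have h3 : i.val + 1 = n := le_antisymm (ZMod.val_lt i) h
      rw [← h2, h3, prod_range_zmod, hp]; simp

lemma eig_iff {ι : Type*} [Fintype ι] (M : Matrix ι ι ℂ) (μ : ℂ) :
    Module.End.HasEigenvalue M.mulVecLin μ ↔ ∃ v : ι → ℂ, v ≠ 0 ∧ ∀ i, ∑ j, M i j * v j = μ * v i := by
  constructor
  · intro h
    obtain ⟨v, hv⟩ := h.exists_hasEigenvector
    refine ⟨v, hv.2, fun i => ?_⟩
    have := congrFun hv.apply_eq_smul i
    simpa [Matrix.mulVec, dotProduct] using this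
  · rintro ⟨v, h0, hv⟩
    refine Module.End.hasEigenvalue_of_hasEigenvector (x := v) ⟨?_, h0⟩
    rw [Module.End.mem_eigenspace_iff]
    funext i
    simpa [Matrix.mulVec, dotProduct] using hv i

lemma eig_transfer {ι : Type*} [Fintype ι] (A N : Matrix ι ι ℂ) (g : ι → ℂ)
    (hg : ∀ i, star (g i) * g i = 1)
    (hN : ∀ i j, N i j = -(star (g i) * A i j * g j)) (μ : ℂ)
    (h : Module.End.HasEigenvalue A.mulVecLin μ) :
    Module.End.HasEigenvalue N.mulVecLin (-μ) := by
  rw [eig_iff] at h ⊢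
  obtain ⟨v, h0, hv⟩ := h
  refine ⟨fun i => star (g i) * v i, ?_, fun i => ?_⟩
  · intro h
    apply h0
    funext i
    have h1 : star (g i) * v i = 0 := congrFun h i
    have h2 := hg i
    simp only [Pi.zero_apply]
    linear_combination g i * h1 - v i * h2
  · calc _ = ∑ j, -star (g i) * (A i j * v j) := by
          refine Finset.sum_congr rfl fun j _ => ?_
          rw [hN]
          linear_combination (-star (g i) * A i j * v j) * hg j
      _ = _ := by rw [← Finset.mul_sum, hv]; ring

/-- Let `n ≥ 3` be odd, let `A` be the adjacency matrix of the cycle `Cₙ`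
and let `N` be the N-matrix of a negative mixed cycle on `n` vertices (weight `−1`).  Then a
real number `λ` is an eigenvalue of `A` iff `−λ` is an eigenvalue of `N`. -/
theorem neg_odd_cycle_eigenvalues_negated
    (n : ℕ) (hn : 3 ≤ n) (hodd : Odd n) [NeZero n]
    (A : Matrix (ZMod n) (ZMod n) ℂ)
    (hA : ∀ i j : ZMod n, A i j = if j = i + 1 ∨ j = i - 1 then 1 else 0)
    (N : Matrix (ZMod n) (ZMod n) ℂ) (hherm : N.IsHermitian)
    (hdiag : ∀ u, N u u = 0)
    (hent : ∀ u v, N u v ∈ ({0, 1, ω6, star ω6} : Set ℂ))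
    (hcyc : ∀ i j : ZMod n, N i j ≠ 0 ↔ (j = i + 1 ∨ j = i - 1))
    (hwt : (∏ i : ZMod n, N i (i + 1)) = -1) :
    ∀ lam : ℝ, Module.End.HasEigenvalue A.mulVecLin (lam : ℂ) ↔
      Module.End.HasEigenvalue N.mulVecLin (-lam : ℂ) := by
  have hs := omega6_star
  have hstep : ∀ i, N i (i + 1) ≠ 0 := fun i => (hcyc i _).2 (Or.inl rfl)
  obtain ⟨g, hg, hgs⟩ := exists_gauge n (fun i => -N i (i + 1)) (by
    intro i
    have h := hent i (i + 1)
    simp only [Set.mem_insert_iff, Set.mem_singleton_iff] at h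
    rcases h with h | h | h | h
    · exact absurd h (hstep i)
    · simp [h]
    · simp only [h, star_neg, neg_mul_neg, hs]
    · simp only [h, star_neg, neg_mul_neg, star_star]; rw [mul_comm, hs]) (by
    rw [Finset.prod_neg, hwt, Finset.card_univ, ZMod.card, hodd.neg_one_pow]; norm_num)
  have hfwd : ∀ i, N i (i + 1) = -(star (g i) * g (i + 1)) := by
    intro i
    rw [hgs]
    linear_combination (-N i (i + 1)) * hg i
  have hN : ∀ i j, N i j = -(star (g i) * A i j * g j) := by
    intro i j
    rw [hA]
    split_ifs with h
    · rcases h with rfl | rfl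
      · rw [hfwd]; ring
      · have h1 := hfwd (i - 1)
        rw [sub_add_cancel] at h1
        rw [← hherm.apply, h1]
        simp only [star_neg, star_mul, star_star]; ring
    · have h2 : N i j = 0 := by
        by_contra h3
        exact h ((hcyc i j).1 h3)
      rw [h2]; ring
  intro lam
  refine ⟨eig_transfer A N g hg hN _, fun h => ?_⟩
  have := eig_transfer N A (fun i => star (g i))
    (fun i => by rw [star_star, mul_comm, hg]) (fun i j => by
      rw [hN, star_star]
      linear_combination (-A i j) * (star (g j) * g j) * hg i - A i j * hg j) _ h
  rwa [neg_neg] at this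
end
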